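/- (Theorem 2(c).) Let a > 0 and X = 0, and set E(b) = (5b²/12 + 1/2)·V₂(b) + (2b/9)·a^{5/2} for b < 0, where V₂(b) = (a'²/2)(π/2 − arctan(X'/√a)) + ((2X'³ − 5a'X')/6)√a with X' = −b/2 and a' = b²/4 + a. If a ≤ 21/10, the equation E(b) = 0 has no solution b < 0. If a > 21/10, then the polynomial P(b) = (21 − 10a)·b² + 12a + 18 has exactly one negative zero b̃₁, and E(b) = 0 has exactly one solution b < 0, which lies in the open interval (b̃₁, 0). -/

import Mathlib

open Real

open Filter Topology Set

/-- The equilibrium function divided by `f * a' ^ 2`, in terms of `r = √a` and `x = X' = -b / 2`. -/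
noncomputable def normalizedEquilibrium (r x : ℝ) : ℝ :=
  (π / 2 - arctan (x / r)) / 2 - (3 * x ^ 3 + 5 * r ^ 2 * x) * r / (6 * (x ^ 2 + r ^ 2) ^ 2) -
    4 * x * r ^ 5 / (9 * ((5 * x ^ 2 / 3 + 1 / 2) * (x ^ 2 + r ^ 2) ^ 2))

/-- The polynomial `P` evaluated at `b = -2 * x`, for `a = r ^ 2`. -/
def derivativePolynomial (r x : ℝ) : ℝ :=
  (84 - 40 * r ^ 2) * x ^ 2 + 12 * r ^ 2 + 18

lemma hasDerivAt_normalizedEquilibrium {r : ℝ} (hr : 0 < r) (x : ℝ) :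
    HasDerivAt (normalizedEquilibrium r)
      (-(r ^ 5 / (54 * (5 * x ^ 2 / 3 + 1 / 2) ^ 2 * (x ^ 2 + r ^ 2) ^ 3)
        * derivativePolynomial r x)) x := by
  have hid := hasDerivAt_id' x
  have hs : (0 : ℝ) < x ^ 2 + r ^ 2 := by positivity
  have hf : (0 : ℝ) < 5 * x ^ 2 / 3 + 1 / 2 := by positivity
  have hsq := hid.pow 2
  have hA := (((hid.div_const r).arctan).const_sub (π / 2)).div_const 2
  have hden := (hsq.add_const (r ^ 2)).pow 2
  have hB := ((((hid.pow 3).const_mul 3).add (hid.const_mul (5 * r ^ 2))).mul_const r).div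
    (hden.const_mul 6) (by simp only [Pi.pow_apply]; positivity)
  have hfd := ((hsq.const_mul 5).div_const 3).add_const (1 / 2)
  have hC := ((hid.const_mul 4).mul_const (r ^ 5)).div ((hfd.mul hden).const_mul 9)
    (by simp only [Pi.pow_apply, Pi.mul_apply]; positivity)
  refine ((hA.sub hB).sub hC).congr_deriv ?_
  have harctan : 1 + (x / r) ^ 2 = (x ^ 2 + r ^ 2) / r ^ 2 := by field_simp; ring
  simp only [Pi.pow_apply, Pi.mul_apply, Pi.add_apply, derivativePolynomial, harctan]
  have hf' : (0 : ℝ) < 5 * x ^ 2 * 2 + 3 := by positivity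
  field_simp
  ring

lemma continuous_normalizedEquilibrium {r : ℝ} (hr : 0 < r) :
    Continuous (normalizedEquilibrium r) :=
  continuous_iff_continuousAt.2 fun x => (hasDerivAt_normalizedEquilibrium hr x).continuousAt

lemma tendsto_normalizedEquilibrium {r : ℝ} (hr : 0 < r) :
    Tendsto (normalizedEquilibrium r) atTop (𝓝 0) := by
  have h1 : Tendsto (fun x : ℝ => (π / 2 - arctan (x / r)) / 2) atTop (𝓝 0) := by
    have h := (tendsto_arctan_atTop.mono_right nhdsWithin_le_nhds).comp
      (tendsto_id.atTop_div_const hr)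
    simpa using (h.const_sub (π / 2)).div_const 2
  have h2 : Tendsto (fun x : ℝ => (3 * x ^ 3 + 5 * r ^ 2 * x) * r / (6 * (x ^ 2 + r ^ 2) ^ 2))
      atTop (𝓝 0) := by
    refine squeeze_zero' ?_ ?_ (tendsto_const_nhds.div_atTop tendsto_id : Tendsto
      (fun x : ℝ => r / x) atTop (𝓝 0))
    · filter_upwards [eventually_gt_atTop 0] with x hx
      positivity
    · filter_upwards [eventually_gt_atTop 0] with x hx
      rw [div_le_div_iff₀ (by positivity) hx]
      have : 0 ≤ r * (3 * x ^ 4 + 7 * r ^ 2 * x ^ 2 + 6 * r ^ 4) := by positivity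
      linarith
  have h3 : Tendsto (fun x : ℝ =>
      4 * x * r ^ 5 / (9 * ((5 * x ^ 2 / 3 + 1 / 2) * (x ^ 2 + r ^ 2) ^ 2))) atTop (𝓝 0) := by
    refine squeeze_zero' ?_ ?_ (tendsto_const_nhds.div_atTop tendsto_id : Tendsto
      (fun x : ℝ => r ^ 3 / x) atTop (𝓝 0))
    · filter_upwards [eventually_gt_atTop 0] with x hx
      positivity
    · filter_upwards [eventually_gt_atTop 0] with x hx
      rw [div_le_div_iff₀ (by positivity) hx]
      have : 0 ≤ r ^ 3 * (15 * x ^ 2 * (x ^ 2 + r ^ 2) ^ 2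
          + 9 / 2 * (x ^ 4 + r ^ 4) + 5 * x ^ 2 * r ^ 2) := by positivity
      linarith
  have h := (h1.sub h2).sub h3
  rwa [sub_zero, sub_zero] at h

lemma strictAntiOn_normalizedEquilibrium {r : ℝ} (hr : 0 < r) {D : Set ℝ} (hD : Convex ℝ D)
    (h : ∀ x ∈ interior D, 0 < derivativePolynomial r x) :
    StrictAntiOn (normalizedEquilibrium r) D := by
  refine strictAntiOn_of_deriv_neg hD (continuous_normalizedEquilibrium hr).continuousOn
    fun x hx => ?_
  rw [(hasDerivAt_normalizedEquilibrium hr x).deriv]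
  have := h x hx
  have : 0 < x ^ 2 + r ^ 2 := by positivity
  exact neg_neg_of_pos (by positivity)

lemma strictMonoOn_normalizedEquilibrium {r : ℝ} (hr : 0 < r) {D : Set ℝ} (hD : Convex ℝ D)
    (h : ∀ x ∈ interior D, derivativePolynomial r x < 0) :
    StrictMonoOn (normalizedEquilibrium r) D := by
  refine strictMonoOn_of_deriv_pos hD (continuous_normalizedEquilibrium hr).continuousOn
    fun x hx => ?_
  rw [(hasDerivAt_normalizedEquilibrium hr x).deriv]
  have : 0 < x ^ 2 + r ^ 2 := by positivity
  exact neg_pos_of_neg (mul_neg_of_pos_of_neg (by positivity) (h x hx))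

lemma StrictMonoOn.lt_of_tendsto_atTop {g : ℝ → ℝ} {c l : ℝ} (hg : StrictMonoOn g (Ici c))
    (hl : Tendsto g atTop (𝓝 l)) {x : ℝ} (hx : c ≤ x) : g x < l := by
  have hx1 : c ≤ x + 1 := by linarith
  refine (hg hx hx1 (lt_add_one x)).trans_le (ge_of_tendsto hl ?_)
  filter_upwards [eventually_ge_atTop (x + 1)] with y hy
  exact hg.monotoneOn hx1 (hx1.trans hy) hy

lemma StrictAntiOn.lt_of_tendsto_atTop {g : ℝ → ℝ} {c l : ℝ} (hg : StrictAntiOn g (Ici c))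
    (hl : Tendsto g atTop (𝓝 l)) {x : ℝ} (hx : c ≤ x) : l < g x :=
  neg_lt_neg_iff.1 (hg.neg.lt_of_tendsto_atTop hl.neg hx)

lemma normalizedEquilibrium_pos {r x : ℝ} (hr : 0 < r) (hr2 : r ^ 2 ≤ 21 / 10) (hx : 0 ≤ x) :
    0 < normalizedEquilibrium r x := by
  refine (strictAntiOn_normalizedEquilibrium hr (convex_Ici 0) fun y _ => ?_).lt_of_tendsto_atTop
    (tendsto_normalizedEquilibrium hr) hx
  have : 0 ≤ (84 - 40 * r ^ 2) * y ^ 2 := mul_nonneg (by linarith) (sq_nonneg y)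
  unfold derivativePolynomial
  positivity

lemma exists_unique_zero_normalizedEquilibrium {r c : ℝ} (hr : 0 < r) (hc : 0 < c)
    (hPc : derivativePolynomial r c = 0) :
    ∃ s ∈ Ioo 0 c, normalizedEquilibrium r s = 0 ∧
      ∀ x, 0 < x → normalizedEquilibrium r x = 0 → x = s := by
  unfold derivativePolynomial at hPc
  have hlead : 84 - 40 * r ^ 2 < 0 :=
    neg_of_mul_neg_left (b := c ^ 2) (by nlinarith) (sq_nonneg c)
  have hanti : StrictAntiOn (normalizedEquilibrium r) (Icc 0 c) := by
    refine strictAntiOn_normalizedEquilibrium hr (convex_Icc 0 c) fun x hx => ?_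
    rw [interior_Icc] at hx
    have : x ^ 2 < c ^ 2 := pow_lt_pow_left₀ hx.2 hx.1.le two_ne_zero
    unfold derivativePolynomial
    nlinarith
  have hmono : StrictMonoOn (normalizedEquilibrium r) (Ici c) := by
    refine strictMonoOn_normalizedEquilibrium hr (convex_Ici c) fun x hx => ?_
    rw [interior_Ici] at hx
    have : c ^ 2 < x ^ 2 := pow_lt_pow_left₀ hx hc.le two_ne_zero
    unfold derivativePolynomial
    nlinarith
  have hneg : ∀ x, c ≤ x → normalizedEquilibrium r x < 0 := fun x hx =>
    hmono.lt_of_tendsto_atTop (tendsto_normalizedEquilibrium hr) hx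
  have hpos : 0 < normalizedEquilibrium r 0 := by
    simp [normalizedEquilibrium, pi_pos]
  obtain ⟨s, hs, hs0⟩ := intermediate_value_Ioo' hc.le
    (continuous_normalizedEquilibrium hr).continuousOn
    (show (0 : ℝ) ∈ Ioo _ _ from ⟨hneg c le_rfl, hpos⟩)
  refine ⟨s, hs, hs0, fun x hx hx0 => ?_⟩
  have hxc : x < c := lt_of_not_ge fun h => (hneg x h).ne hx0
  exact hanti.injOn ⟨hx.le, hxc.le⟩ ⟨hs.1.le, hs.2.le⟩ (hx0.trans hs0.symm)

theorem stmt_11 (a : ℝ) (ha : 0 < a)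
    (X' : ℝ → ℝ) (hX' : ∀ b, X' b = -b / 2)
    (a' : ℝ → ℝ) (ha' : ∀ b, a' b = b ^ 2 / 4 + a)
    (V₂ : ℝ → ℝ)
    (hV₂ : ∀ b, V₂ b = a' b ^ 2 / 2 * (π / 2 - Real.arctan (X' b / Real.sqrt a)) +
        (2 * X' b ^ 3 - 5 * a' b * X' b) / 6 * Real.sqrt a)
    (E : ℝ → ℝ)
    (hE : ∀ b, E b = (5 * b ^ 2 / 12 + 1 / 2) * V₂ b + 2 * b / 9 * a ^ ((5 : ℝ) / 2))
    (P : ℝ → ℝ)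
    (hP : ∀ b, P b = (21 - 10 * a) * b ^ 2 + 12 * a + 18) :
    (a ≤ 21 / 10 → ¬ ∃ b < 0, E b = 0) ∧
    (21 / 10 < a →
      ∃ bt₁ : ℝ, bt₁ < 0 ∧ P bt₁ = 0 ∧ (∀ b < 0, P b = 0 → b = bt₁) ∧
        ∃ s ∈ Set.Ioo bt₁ (0 : ℝ), E s = 0 ∧ ∀ b < 0, E b = 0 → b = s) := by
  obtain ⟨r, hr, rfl⟩ : ∃ r : ℝ, 0 < r ∧ a = r ^ 2 :=
    ⟨√a, sqrt_pos.2 ha, (sq_sqrt ha.le).symm⟩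
  have hpow : (r ^ 2) ^ ((5 : ℝ) / 2) = r ^ 5 := by
    rw [← rpow_natCast r 2, ← rpow_mul hr.le, ← rpow_natCast r 5]
    norm_num
  have hEG : ∀ b, E b = (5 * b ^ 2 / 12 + 1 / 2) * (b ^ 2 / 4 + r ^ 2) ^ 2 *
      normalizedEquilibrium r (-b / 2) := by
    intro b
    have hs : (0 : ℝ) < b ^ 2 + 4 * r ^ 2 := by positivity
    have hf : (0 : ℝ) < 5 * b ^ 2 + 6 := by positivity
    have h1 : (-b / 2) ^ 2 + r ^ 2 = (b ^ 2 + 4 * r ^ 2) / 4 := by ring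
    have h2 : 5 * (-b / 2) ^ 2 / 3 + 1 / 2 = (5 * b ^ 2 + 6) / 12 := by ring
    rw [hE, hV₂, hX', ha', hpow, sqrt_sq hr.le, normalizedEquilibrium, h1, h2]
    generalize arctan (-b / 2 / r) = θ
    field_simp
    ring
  have hE0 : ∀ b, E b = 0 ↔ normalizedEquilibrium r (-b / 2) = 0 := by
    intro b
    rw [hEG, mul_eq_zero_iff_left (by positivity)]
  refine ⟨?_, fun h => ?_⟩
  · rintro h ⟨b, hb, hb0⟩
    exact (normalizedEquilibrium_pos hr h (by linarith)).ne' ((hE0 b).1 hb0)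
  · have hden : 0 < 10 * r ^ 2 - 21 := by linarith
    obtain ⟨c, hc, hc2⟩ : ∃ c : ℝ, 0 < c ∧ (10 * r ^ 2 - 21) * (4 * c ^ 2) = 12 * r ^ 2 + 18 := by
      have hq : 0 < (12 * r ^ 2 + 18) / (4 * (10 * r ^ 2 - 21)) := by positivity
      refine ⟨_, sqrt_pos.2 hq, ?_⟩
      rw [sq_sqrt hq.le]
      field_simp
    obtain ⟨s, hs, hs0, huniq⟩ := exists_unique_zero_normalizedEquilibrium hr hc
      (by unfold derivativePolynomial; linarith)
    refine ⟨-2 * c, by linarith, by rw [hP]; linarith, fun b hb hb0 => ?_, -2 * s,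
      ⟨by linarith [hs.2], by linarith [hs.1]⟩, ?_, fun b hb hb0 => ?_⟩
    · rw [hP] at hb0
      have hsq : (-b) ^ 2 = (2 * c) ^ 2 := mul_left_cancel₀ hden.ne' (by linarith)
      linarith [(pow_left_inj₀ (by linarith) (by linarith) two_ne_zero).1 hsq]
    · rw [hE0, show -(-2 * s) / 2 = s by ring]
      exact hs0
    · linarith [huniq _ (by linarith) ((hE0 b).1 hb0)]
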